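/- Let p be an odd prime and let l be an integer with 1 ≤ l ≤ (p−1)/2. Then the polynomial ∂_1^l(N_1) ∈ k[V_3] is not divisible by x_3^l; in fact, writing ∂_1^l(N_1) as a polynomial in x_3, the coefficient of x_3^{l−1} is nonzero. -/

import Mathlib

open MvPolynomial

/-- The algebra automorphism `σ` of `k[V_3] = k[x_1,x_2,x_3]` given by
`σ x_1 = x_1 + x_2`, `σ x_2 = x_2 + x_3`, `σ x_3 = x_3` (0-indexed). -/
noncomputable def sigmaHom (k : Type*) [CommRing k] (m : ℕ) :
    MvPolynomial (Fin m) k →ₐ[k] MvPolynomial (Fin m) k :=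
  aeval (fun i : Fin m =>
    X i + if h : (i : ℕ) + 1 < m then X (⟨(i : ℕ) + 1, h⟩ : Fin m) else 0)

/-- The norm `N_1 = ∏_{i=0}^{p−1} σ^i(x_1)` in `k[V_3]`. -/
noncomputable def N1 (p : ℕ) (k : Type*) [CommRing k] : MvPolynomial (Fin 3) k :=
  ∏ i ∈ Finset.range p, (⇑(sigmaHom k 3))^[i] (X 0)

/-- The Artin–Schreier product `∏_{i < p} (a + i b) = a^p - b^(p-1) a` in characteristic `p`. -/
theorem prod_range_add_natCast_mul {K : Type*} [Field K] (p : ℕ) [hp : Fact p.Prime] [CharP K p]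
    (a b : K) : ∏ i ∈ Finset.range p, (a + i * b) = a ^ p - b ^ (p - 1) * a := by
  have hp0 : p ≠ 0 := hp.out.ne_zero
  have hp1 : p - 1 ≠ 0 := by have := hp.out.two_le; omega
  rcases eq_or_ne b 0 with rfl | hb
  · simp [hp1]
  have h1 : (∏ c : ZMod p, (Polynomial.X - Polynomial.C c)) =
      (Polynomial.X ^ p - Polynomial.X : Polynomial (ZMod p)) := by
    have hr := FiniteField.roots_X_pow_card_sub_X (ZMod p)
    rw [ZMod.card] at hr
    have := Polynomial.prod_multiset_X_sub_C_of_monic_of_roots_card_eq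
      (p := (Polynomial.X ^ p - Polynomial.X : Polynomial (ZMod p)))
      (Polynomial.monic_X_pow_sub (by
        rw [Polynomial.degree_X]; exact_mod_cast hp.out.one_lt))
      (by rw [hr, FiniteField.X_pow_card_sub_X_natDegree_eq _ hp.out.one_lt]
          simp [ZMod.card])
    rw [hr] at this
    exact this
  have h2 := congrArg (Polynomial.eval₂ (ZMod.castHom dvd_rfl K) (-(a / b))) h1
  rw [Polynomial.eval₂_finsetProd] at h2
  simp only [Polynomial.eval₂_sub, Polynomial.eval₂_X, Polynomial.eval₂_C,
    Polynomial.eval₂_pow] at h2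
  have h3 : ∏ c : ZMod p, (-(a / b) - ZMod.castHom dvd_rfl K c) =
      ∏ i ∈ Finset.range p, (-(a / b) - (i : K)) := by
    refine Finset.prod_nbij' (fun c => c.val) (fun i => (i : ZMod p)) ?_ ?_ ?_ ?_ ?_
    · intro c _; simpa using ZMod.val_lt c
    · simp
    · simp
    · intro i hi; exact ZMod.val_cast_of_lt (by simpa using hi)
    · intro c _
      conv_lhs => rw [← ZMod.natCast_zmod_val c, map_natCast]
  rw [h3] at h2
  have h4 : ∏ i ∈ Finset.range p, (a + i * b) =
      (-b) ^ p * ∏ i ∈ Finset.range p, (-(a / b) - (i : K)) := by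
    conv_rhs => rw [← Finset.card_range p, ← Finset.prod_const, Finset.card_range]
    rw [← Finset.prod_mul_distrib]
    refine Finset.prod_congr rfl fun i _ => ?_
    field_simp
    ring
  rw [h4, h2, mul_sub, ← mul_pow]
  have h5 : -b * -(a / b) = a := by field_simp
  have h6 : (-b) ^ p = -(b ^ (p - 1) * b) := by
    rw [← pow_succ, Nat.sub_add_cancel hp.out.one_le]
    simpa [zero_pow hp0] using sub_pow_char (0 : K) b (p := p)
  rw [h5, h6]
  field_simp

/-- Closed form, in a field of odd characteristic `p = 2m + 1`, for the product of the quadratic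
forms `x + i y + (i choose 2) z`. -/
theorem four_mul_prod_quadratic_of_isSquare {K : Type*} [Field K] (p m : ℕ) [hp : Fact p.Prime]
    [CharP K p] (hm : p = 2 * m + 1) (x y z d : K) (hz : z ≠ 0)
    (hd : d ^ 2 = (2 * y - z) ^ 2 - 8 * x * z) :
    4 * z * ∏ i ∈ Finset.range p, (x + i * y + (i.choose 2 : ℕ) * z) =
      4 * x ^ p * z + 4 * x * z ^ p - (2 * y - z) ^ (p + 1) +
        ((2 * y - z) ^ 2 - 8 * x * z) ^ (m + 1) := by
  have hm0 : m ≠ 0 := by rintro rfl; exact hp.out.one_lt.ne' (by omega)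
  have h2 : (2 : K) ≠ 0 := by
    have : ((2 : ℕ) : K) ≠ 0 := by
      rw [Ne, CharP.cast_eq_zero_iff K p]
      intro h
      have := Nat.le_of_dvd two_pos h
      omega
    exact_mod_cast this
  have hnat : ∀ n : ℕ, (n : K) ^ p = n := map_natCast (frobenius K p)
  have h2p : (2 : K) ^ p = 2 := by exact_mod_cast hnat 2
  have h8p : (8 : K) ^ p = 8 := by exact_mod_cast hnat 8
  have h2q : (2 : K) ^ (p - 1) = 1 := by
    have : (2 : K) ^ (p - 1) * 2 = 1 * 2 := by
      rw [← pow_succ, Nat.sub_add_cancel hp.out.one_le, h2p, one_mul]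
    exact mul_right_cancel₀ h2 this
  set Y := 2 * y - z with hY
  have key : (8 * z) ^ p * ∏ i ∈ Finset.range p, (x + i * y + (i.choose 2 : ℕ) * z) =
      (∏ i ∈ Finset.range p, ((Y - d) + i * (2 * z))) *
        ∏ i ∈ Finset.range p, ((Y + d) + i * (2 * z)) := by
    conv_lhs => rw [← Finset.card_range p, ← Finset.prod_const, Finset.card_range]
    rw [← Finset.prod_mul_distrib, ← Finset.prod_mul_distrib]
    refine Finset.prod_congr rfl fun i _ => ?_
    have hc : ((i.choose 2 : ℕ) : K) * 2 = i * (i - 1) := by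
      have : NeZero (2 : K) := ⟨h2⟩
      rw [Nat.cast_choose_two]; field_simp
    linear_combination (4 * z ^ 2) * hc + hd - 4 * i * z * hY
  rw [prod_range_add_natCast_mul, prod_range_add_natCast_mul, mul_pow 2 z, h2q, one_mul, mul_pow,
    h8p] at key
  have hsum : (Y - d) ^ p * (Y + d) ^ p = 8 * x ^ p * z ^ p := by
    rw [← mul_pow, show 8 * x ^ p * z ^ p = (8 * x * z) ^ p by rw [mul_pow, mul_pow, h8p]]
    congr 1
    linear_combination -hd
  have hsub : (Y - d) ^ p = Y ^ p - d ^ p := sub_pow_char Y d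
  have hadd : (Y + d) ^ p = Y ^ p + d ^ p := add_pow_char Y d p
  have hpow : (Y ^ 2 - 8 * x * z) ^ (m + 1) = d ^ p * d := by
    rw [← hd, ← pow_mul, ← pow_succ]; congr 1; omega
  have hzp : z ^ p = z ^ (p - 1) * z := by
    rw [← pow_succ, Nat.sub_add_cancel hp.out.one_le]
  have hzq : (2 * z ^ (p - 1)) ≠ 0 := mul_ne_zero h2 (pow_ne_zero _ hz)
  rw [hpow, pow_succ Y p]
  refine mul_left_cancel₀ hzq ?_
  set P := ∏ i ∈ Finset.range p, (x + i * y + (i.choose 2 : ℕ) * z)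
  have expand : 8 * z ^ p * P = (Y - d) ^ p * (Y + d) ^ p
      - z ^ (p - 1) * ((Y ^ p - d ^ p) * (Y + d) + (Y ^ p + d ^ p) * (Y - d))
      + z ^ (p - 1) * z ^ (p - 1) * (Y ^ 2 - d ^ 2) := by
    rw [key, ← hsub, ← hadd]; ring
  rw [hsum, hd] at expand
  rw [hzp] at expand ⊢
  linear_combination expand

/-- Closed form, in a domain of odd characteristic `p = 2m + 1`, for the product of the quadratic
forms `x + i y + (i choose 2) z`. -/
theorem four_mul_prod_quadratic {A : Type*} [CommRing A] [IsDomain A] (p m : ℕ) [Fact p.Prime]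
    [CharP A p] (hm : p = 2 * m + 1) (x y z : A) (hz : z ≠ 0) :
    4 * z * ∏ i ∈ Finset.range p, (x + i * y + (i.choose 2 : ℕ) * z) =
      4 * x ^ p * z + 4 * x * z ^ p - (2 * y - z) ^ (p + 1) +
        ((2 * y - z) ^ 2 - 8 * x * z) ^ (m + 1) := by
  let f : A →+* AlgebraicClosure (FractionRing A) :=
    (algebraMap (FractionRing A) _).comp (algebraMap A _)
  have hf : Function.Injective f :=
    (algebraMap (FractionRing A) _).injective.comp (IsFractionRing.injective A _)
  have : CharP (AlgebraicClosure (FractionRing A)) p := charP_of_injective_ringHom hf p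
  obtain ⟨d, hd⟩ := IsAlgClosed.exists_pow_nat_eq
    ((2 * f y - f z) ^ 2 - 8 * f x * f z) two_pos
  apply hf
  have := four_mul_prod_quadratic_of_isSquare p m hm (f x) (f y) (f z) d
    ((map_ne_zero_iff f hf).2 hz) hd
  simpa only [map_prod, map_mul, map_add, map_sub, map_pow, map_natCast, map_ofNat] using this

theorem sigmaHom_iterate_X_zero (k : Type*) [CommRing k] (i : ℕ) :
    (⇑(sigmaHom k 3))^[i] (X 0) = X 0 + (i : MvPolynomial (Fin 3) k) * X 1
      + ((i.choose 2 : ℕ) : MvPolynomial (Fin 3) k) * X 2 := by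
  have h0 : sigmaHom k 3 (X 0) = X 0 + X 1 := by simp [sigmaHom]
  have h1 : sigmaHom k 3 (X 1) = X 1 + X 2 := by simp [sigmaHom]
  have h2 : sigmaHom k 3 (X 2) = X 2 := by simp [sigmaHom]
  induction i with
  | zero => simp
  | succ i ih =>
    rw [Function.iterate_succ_apply', ih]
    simp only [map_add, map_mul, map_natCast, h0, h1, h2, Nat.choose_succ_succ' i 1,
      Nat.choose_one_right]
    push_cast
    ring

/-- The dehomogenization `x_1 ↦ X`, `x_2 ↦ 1`, `x_3 ↦ Z` from `k[x_1,x_2,x_3]` to `k[Z][X]`. -/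
noncomputable def dehomog (k : Type*) [CommRing k] :
    MvPolynomial (Fin 3) k →ₐ[k] Polynomial (Polynomial k) :=
  aeval ![Polynomial.X, 1, Polynomial.C Polynomial.X]

theorem dehomog_pderiv {k : Type*} [CommRing k] (f : MvPolynomial (Fin 3) k) :
    dehomog k (pderiv 0 f) = Polynomial.derivative (dehomog k f) := by
  induction f using MvPolynomial.induction_on with
  | C a => simp [dehomog, Polynomial.algebraMap_apply]
  | add f g hf hg => simp [hf, hg]
  | mul_X f i hf =>
    rw [pderiv_mul, map_add, map_mul, map_mul, map_mul, hf, Polynomial.derivative_mul]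
    fin_cases i <;> simp [dehomog, pderiv_X]

theorem dehomog_pderiv_iterate {k : Type*} [CommRing k] (l : ℕ) (f : MvPolynomial (Fin 3) k) :
    dehomog k ((⇑(pderiv 0))^[l] f) = Polynomial.derivative^[l] (dehomog k f) :=
  Function.Semiconj.iterate_right (f := dehomog k) (dehomog_pderiv (k := k)) l f

theorem exists_coeff_ne_zero_of_dehomog {k : Type*} [CommRing k] {f : MvPolynomial (Fin 3) k}
    {a n : ℕ} (h : ((dehomog k f).coeff a).coeff n ≠ 0) :
    ∃ d : Fin 3 →₀ ℕ, d 2 = n ∧ coeff d f ≠ 0 := by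
  by_contra! hc
  apply h
  rw [dehomog, aeval_def, eval₂_eq', Polynomial.finsetSum_coeff, Polynomial.finsetSum_coeff]
  refine Finset.sum_eq_zero fun d hd => ?_
  have hdn : d 2 ≠ n := fun hdn => mem_support_iff.1 hd (hc d hdn)
  have hterm : algebraMap k (Polynomial (Polynomial k)) (coeff d f) *
      ∏ i, (![Polynomial.X, 1, Polynomial.C Polynomial.X] :
        Fin 3 → Polynomial (Polynomial k)) i ^ d i =
      Polynomial.C (Polynomial.C (coeff d f) * Polynomial.X ^ d 2) * Polynomial.X ^ d 0 := by
    simp [Fin.prod_univ_three, Polynomial.algebraMap_apply]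
    ring
  rw [hterm, Polynomial.coeff_C_mul, Polynomial.coeff_X_pow]
  split_ifs
  · rw [mul_one, Polynomial.coeff_C_mul, Polynomial.coeff_X_pow, if_neg (Ne.symm hdn), mul_zero]
  · simp

theorem coeff_C_mul_X_add_C_pow {R : Type*} [CommRing R] (a b : R) (n l : ℕ) :
    ((Polynomial.C a * Polynomial.X + Polynomial.C b) ^ n).coeff l =
      b ^ (n - l) * (n.choose l : ℕ) * a ^ l := by
  have h : (Polynomial.C a * Polynomial.X + Polynomial.C b) ^ n =
      ((Polynomial.X + Polynomial.C b) ^ n).comp (Polynomial.C a * Polynomial.X) := by simp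
  rw [h, Polynomial.comp_C_mul_X_coeff, Polynomial.coeff_X_add_C_pow]

theorem coeff_eq_zero_of_X_pow_dvd {σ R : Type*} [CommRing R] {f : MvPolynomial σ R} {i : σ}
    {l : ℕ} (h : X i ^ l ∣ f) {d : σ →₀ ℕ} (hd : d i < l) : coeff d f = 0 := by
  classical
  obtain ⟨g, rfl⟩ := h
  rw [X_pow_eq_monomial, coeff_monomial_mul', if_neg]
  intro hle
  have := hle i
  simp at this
  omega

theorem dehomog_N1 (k : Type*) [CommRing k] (p : ℕ) :
    dehomog k (N1 p k) = ∏ i ∈ Finset.range p, (Polynomial.X + (i : Polynomial (Polynomial k)) * 1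
      + ((i.choose 2 : ℕ) : Polynomial (Polynomial k)) * Polynomial.C Polynomial.X) := by
  simp [N1, sigmaHom_iterate_X_zero, map_prod, dehomog]

theorem coeff_coeff_dehomog_N1_ne_zero {k : Type*} [Field k] (p m l : ℕ) [hp : Fact p.Prime]
    [CharP k p] (hm : p = 2 * m + 1) (hl1 : 1 ≤ l) (hlm : l ≤ m) :
    ((dehomog k (N1 p k)).coeff l).coeff (l - 1) ≠ 0 := by
  have hcast : ∀ n : ℕ, ¬ p ∣ n → (n : k) ≠ 0 := fun n hn h =>
    hn ((CharP.cast_eq_zero_iff k p n).1 h)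
  have h2 : (2 : k) ≠ 0 := by
    exact_mod_cast hcast 2 fun h => by have := Nat.le_of_dvd two_pos h; omega
  have hch : (((m + 1).choose l : ℕ) : k) ≠ 0 := hcast _ fun h => by
    have := (Nat.choose_mul_factorial_mul_factorial (n := m + 1) (k := l) (by omega))
    have h' : p ∣ (m + 1).factorial := by
      rw [← this, mul_assoc]; exact Dvd.dvd.mul_right h _
    have := (hp.out.dvd_factorial).1 h'
    omega
  have hC2 : Polynomial.C (2 : Polynomial k) = 2 := map_ofNat _ 2
  have hC4 : Polynomial.C (4 : Polynomial k) = 4 := map_ofNat _ 4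
  have hC8 : Polynomial.C (8 : Polynomial k) = 8 := map_ofNat _ 8
  have hC4' : Polynomial.C (4 : k) = 4 := map_ofNat _ 4
  have hC8' : Polynomial.C (8 : k) = 8 := map_ofNat _ 8
  have key := four_mul_prod_quadratic p m hm (Polynomial.X : Polynomial (Polynomial k)) 1
    (Polynomial.C Polynomial.X) (by simp)
  rw [← dehomog_N1] at key
  set F := dehomog k (N1 p k)
  intro h0
  have hL : ((4 * Polynomial.C Polynomial.X * F).coeff l).coeff l = 0 := by
    obtain ⟨l, rfl⟩ := Nat.exists_eq_add_of_le' hl1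
    rw [show (4 * Polynomial.C Polynomial.X * F) =
      Polynomial.C (Polynomial.C 4 * Polynomial.X) * F by simp [hC4, hC4'],
      Polynomial.coeff_C_mul, mul_assoc,
      Polynomial.coeff_C_mul, Polynomial.coeff_X_mul]
    simpa using Or.inr h0
  have hR1 : ((4 * (Polynomial.X : Polynomial (Polynomial k)) ^ p *
      Polynomial.C Polynomial.X).coeff l).coeff l = 0 := by
    rw [show (4 * (Polynomial.X : Polynomial (Polynomial k)) ^ p * Polynomial.C Polynomial.X) =
      Polynomial.C (4 * Polynomial.X) * Polynomial.X ^ p by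
        simp [hC4], Polynomial.coeff_C_mul,
      Polynomial.coeff_X_pow, if_neg (by omega)]
    simp
  have hR2 : ((4 * (Polynomial.X : Polynomial (Polynomial k)) *
      Polynomial.C Polynomial.X ^ p).coeff l).coeff l = 0 := by
    rw [show (4 * (Polynomial.X : Polynomial (Polynomial k)) * Polynomial.C Polynomial.X ^ p) =
      Polynomial.C (Polynomial.C 4 * Polynomial.X ^ p) * Polynomial.X by simp [hC4, hC4']; ring,
      Polynomial.coeff_C_mul, Polynomial.coeff_X]
    split_ifs
    · rw [mul_one, Polynomial.coeff_C_mul, Polynomial.coeff_X_pow, if_neg (by omega), mul_zero]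
    · simp
  have hR3 : (((2 * 1 - Polynomial.C Polynomial.X : Polynomial (Polynomial k)) ^ (p + 1)).coeff
      l).coeff l = 0 := by
    rw [show ((2 * 1 - Polynomial.C Polynomial.X : Polynomial (Polynomial k)) ^ (p + 1)) =
      Polynomial.C ((2 - Polynomial.X) ^ (p + 1)) by simp [hC2], Polynomial.coeff_C, if_neg (by omega)]
    simp
  have hR4 : ((((2 * 1 - Polynomial.C Polynomial.X : Polynomial (Polynomial k)) ^ 2 -
      8 * Polynomial.X * Polynomial.C Polynomial.X) ^ (m + 1)).coeff l).coeff l =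
      (-8 : k) ^ l * (2 ^ 2) ^ (m + 1 - l) * ((m + 1).choose l : ℕ) := by
    have e : ((2 * 1 - Polynomial.C Polynomial.X : Polynomial (Polynomial k)) ^ 2 -
      8 * Polynomial.X * Polynomial.C Polynomial.X) =
      Polynomial.C (Polynomial.C (-8) * Polynomial.X) * Polynomial.X +
        Polynomial.C ((2 - Polynomial.X) ^ 2) := by
      simp [hC2, hC8, hC8']; ring
    rw [e, coeff_C_mul_X_add_C_pow, mul_pow, ← mul_assoc, Polynomial.coeff_mul_X_pow',
      if_pos le_rfl, Nat.sub_self, Polynomial.coeff_zero_eq_eval_zero]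
    simp
    ring
  rw [key, Polynomial.coeff_add, Polynomial.coeff_sub, Polynomial.coeff_add, Polynomial.coeff_add,
    Polynomial.coeff_sub, Polynomial.coeff_add, hR1, hR2, hR3, hR4] at hL
  have h8 : (-8 : k) ≠ 0 := by
    rw [show (-8 : k) = -(2 ^ 3) by norm_num]; exact neg_ne_zero.2 (pow_ne_zero _ h2)
  simp [h8, h2, hch] at hL

/-- Let `p` be an odd prime and `1 ≤ l ≤ (p−1)/2`.  Then `∂_1^l(N_1)` is not
divisible by `x_3^l`; in fact, written as a polynomial in `x_3`, its
coefficient of `x_3^{l−1}` is nonzero (i.e. some monomial with `x_3`-exponent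
`l−1` occurs in `∂_1^l(N_1)` with nonzero coefficient). -/
theorem statement16 (p : ℕ) (hp : p.Prime) (hodd : Odd p)
    (k : Type*) [Field k] [CharP k p]
    (l : ℕ) (hl1 : 1 ≤ l) (hlp : l ≤ (p - 1) / 2) :
    ¬ ((X 2 : MvPolynomial (Fin 3) k) ^ l ∣
        (⇑(pderiv (0 : Fin 3)))^[l] (N1 p k)) ∧
    ∃ dd : Fin 3 →₀ ℕ, dd 2 = l - 1 ∧
      coeff dd ((⇑(pderiv (0 : Fin 3)))^[l] (N1 p k)) ≠ 0 := by
  have : Fact p.Prime := ⟨hp⟩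
  obtain ⟨m, hm⟩ := hodd
  have hN := coeff_coeff_dehomog_N1_ne_zero (k := k) p m l hm hl1 (by omega)
  have hfac : (l.factorial : k) ≠ 0 := by
    rw [Ne, CharP.cast_eq_zero_iff k p, hp.dvd_factorial]
    omega
  have hex : ∃ dd : Fin 3 →₀ ℕ, dd 2 = l - 1 ∧
      coeff dd ((⇑(pderiv (0 : Fin 3)))^[l] (N1 p k)) ≠ 0 := by
    apply exists_coeff_ne_zero_of_dehomog (a := 0)
    rw [dehomog_pderiv_iterate, Polynomial.coeff_iterate_derivative, zero_add,
      Nat.descFactorial_self, Polynomial.coeff_smul, nsmul_eq_mul]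
    exact mul_ne_zero hfac hN
  refine ⟨fun hdvd => ?_, hex⟩
  obtain ⟨d, hd, hne⟩ := hex
  exact hne (coeff_eq_zero_of_X_pow_dvd hdvd (by omega))
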